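/- arXiv:0802.4462 — 2 statements merged into one kernel-verified Lean document; each statement's English description precedes it below -/
import Mathlib

section
/- Let N be a natural number with N ≥ 1, let λ, μ : Fin N → ℝ with λ_i > 0 and μ_i > 0 for all i, set Δ i = (⌈μ_i⌉ : ℝ) − μ_i, and for a sign pattern s : Fin N → Bool define δ_i^s = Δ i − (if s i then 1 else 0). Define S : ℝ → ℝ by S(t) = ∑_{s : Fin N → Bool} ∏_i (λ_i μ_i)^(t · δ_i^s) / ( Γ(1 + μ_i + t · δ_i^s) )². Then the function t ↦ ln S(t) is differentiable at t = 0 with derivative ∑_i ( ln(λ_i μ_i) − 2 · Γ'(1 + μ_i)/Γ(1 + μ_i) ) · (Δ i − 1/2), where Γ is the real Gamma function and Γ' its derivative. -/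
/-- Derivative at `0` of `t ↦ a ^ (t d) / Γ(c + t d) ^ 2`. -/
theorem hasDerivAt_rpow_div_Gamma_sq {a c : ℝ} (ha : 0 < a) (hc : 0 < c) (d : ℝ) :
    HasDerivAt (fun t : ℝ => a ^ (t * d) / Real.Gamma (c + t * d) ^ 2)
      ((Real.log a - 2 * deriv Real.Gamma c / Real.Gamma c) * d / Real.Gamma c ^ 2) 0 := by
  have hΓ : Real.Gamma c ≠ 0 := (Real.Gamma_pos_of_pos hc).ne'
  have hlin : HasDerivAt (fun t : ℝ => t * d) d 0 := by
    simpa using (hasDerivAt_id (0 : ℝ)).mul_const d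
  have hpow : HasDerivAt (fun t : ℝ => a ^ (t * d)) (Real.log a * d) 0 := by
    simpa using hlin.const_rpow ha
  have hdiff : DifferentiableAt ℝ Real.Gamma (c + 0 * d) := by
    refine Real.differentiableAt_Gamma fun m => ?_
    have : (0 : ℝ) ≤ m := m.cast_nonneg
    linarith
  have hGamma : HasDerivAt (fun t : ℝ => Real.Gamma (c + t * d)) (deriv Real.Gamma c * d) 0 := by
    simpa [Function.comp_def] using hdiff.hasDerivAt.comp (0 : ℝ) (hlin.const_add c)
  refine (hpow.fun_div (hGamma.fun_pow 2) (by simpa using hΓ)).congr_deriv ?_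
  simp only [zero_mul, add_zero, Real.rpow_zero]
  field_simp
  norm_num
  ring

/-- The logarithm of a finite product has as derivative the sum of the logarithmic derivatives. -/
theorem HasDerivAt.log_finsetProd {ι : Type*} [Fintype ι] {g : ι → ℝ → ℝ} {g' : ι → ℝ} {x : ℝ}
    (hg : ∀ i, HasDerivAt (g i) (g' i) x) (hx : ∀ i, g i x ≠ 0) :
    HasDerivAt (fun t => Real.log (∏ i, g i t)) (∑ i, g' i / g i x) x := by
  refine (HasDerivAt.fun_sum fun i _ => (hg i).log (hx i)).congr_of_eventuallyEq ?_
  filter_upwards [Filter.eventually_all.2 fun i => (hg i).continuousAt.eventually_ne (hx i)]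
    with t ht
  exact Real.log_prod fun i _ => ht i


/-- The scaled version `S(t)` of the paper's quantity `Σ̂`, with deviations
`δ_i^s = Δ i − (if s i then 1 else 0)` and `Δ i = ⌈μ_i⌉ − μ_i`, has
`ln S` differentiable at `t = 0` with derivative
`∑_i (ln(λ_i μ_i) − 2 Γ'(1+μ_i)/Γ(1+μ_i)) (Δ i − 1/2)`. -/
theorem hasDerivAt_log_sigma_hat (N : ℕ) (hN : 1 ≤ N) (lam μ : Fin N → ℝ)
    (hlam : ∀ i, 0 < lam i) (hμ : ∀ i, 0 < μ i) :
    HasDerivAt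
      (fun t : ℝ => Real.log (∑ s : Fin N → Bool, ∏ i,
        (lam i * μ i) ^ (t * (((⌈μ i⌉ : ℝ) - μ i) - if s i then 1 else 0)) /
          (Real.Gamma (1 + μ i + t * (((⌈μ i⌉ : ℝ) - μ i) - if s i then 1 else 0))) ^ 2))
      (∑ i, (Real.log (lam i * μ i) -
          2 * deriv Real.Gamma (1 + μ i) / Real.Gamma (1 + μ i)) *
        (((⌈μ i⌉ : ℝ) - μ i) - 1 / 2)) 0 := by
  have hfactor (t : ℝ) : (∑ s : Fin N → Bool, ∏ i,
      (lam i * μ i) ^ (t * (((⌈μ i⌉ : ℝ) - μ i) - if s i then 1 else 0)) /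
        (Real.Gamma (1 + μ i + t * (((⌈μ i⌉ : ℝ) - μ i) - if s i then 1 else 0))) ^ 2) =
      ∏ i, ∑ b : Bool, (lam i * μ i) ^ (t * (((⌈μ i⌉ : ℝ) - μ i) - if b then 1 else 0)) /
        (Real.Gamma (1 + μ i + t * (((⌈μ i⌉ : ℝ) - μ i) - if b then 1 else 0))) ^ 2 := by
    rw [Finset.prod_univ_sum, Fintype.piFinset_univ]
  simp only [hfactor]
  have hc (i : Fin N) : 0 < 1 + μ i := by linarith [hμ i]
  have hΓ (i : Fin N) : Real.Gamma (1 + μ i) ≠ 0 := (Real.Gamma_pos_of_pos (hc i)).ne'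
  refine (HasDerivAt.log_finsetProd (fun i => HasDerivAt.fun_sum fun (b : Bool) _ =>
    hasDerivAt_rpow_div_Gamma_sq (mul_pos (hlam i) (hμ i)) (hc i)
      (((⌈μ i⌉ : ℝ) - μ i) - if b then 1 else 0)) fun i => ?_).congr_deriv ?_
  · simp [hΓ i]
  · refine Finset.sum_congr rfl fun i _ => ?_
    have := hΓ i
    simp only [Fintype.sum_bool, zero_mul, add_zero, Real.rpow_zero, if_true, Bool.false_eq_true,
      if_false, sub_zero]
    field_simp
    ring
end

section
/- Let N be a natural number with N ≥ 1, let λ, μ : Fin N → ℝ with λ_i > 0 and μ_i > 0 for all i, set Δ i = (⌈μ_i⌉ : ℝ) − μ_i, and for a sign pattern s : Fin N → Bool define δ_i^s = Δ i − (if s i then 1 else 0). Define ε = 2^N · exp(−∑_i μ_i) · ∏_i μ_i^(μ_i) / Γ(1 + μ_i), A = exp(−∑_i (λ_i + μ_i)) · (1/ε) · ∑_{s : Fin N → Bool} ∏_i (λ_i μ_i)^(μ_i + δ_i^s) / (Γ(1 + μ_i + δ_i^s))², and Σ̂ = ∑_{s : Fin N → Bool} ∏_i (λ_i μ_i)^(δ_i^s)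 / (Γ(1 + μ_i + δ_i^s))². Then A > 0, Σ̂ > 0, and ln A = −N · ln 2 + ∑_i ( −λ_i + μ_i · ln λ_i + ln Γ(1 + μ_i) ) + ln Σ̂. -/
/-- Shifting a positive real up to its ceiling, or one below it, keeps the Gamma function
at one plus the result positive. -/
lemma Gamma_one_add_ceil_shift_pos {x : ℝ} (hx : 0 < x) (b : Bool) :
    0 < Real.Gamma (1 + x + ((⌈x⌉ : ℝ) - x - if b then 1 else 0)) := by
  have hceil : (1 : ℝ) ≤ ⌈x⌉ := by exact_mod_cast Int.ceil_pos.mpr hx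
  apply Real.Gamma_pos_of_pos
  split_ifs <;> linarith

/-- Exact decomposition of the restricted ensemble-averaged log-likelihood `ln A = ln ⟨L⟩_ε`
used in the paper's central theorem: with fiducial means `μ_i`, model means `λ_i`,
deviations `δ_i^s = Δ i − (if s i then 1 else 0)` where `Δ i = ⌈μ_i⌉ − μ_i`, total
probability `ε`, averaged likelihood `A`, and `Σ̂` collecting the `δ`-dependent factors,
one has `A > 0`, `Σ̂ > 0`, and
`ln A = −N ln 2 + ∑_i (−λ_i + μ_i ln λ_i + ln Γ(1+μ_i)) + ln Σ̂`. -/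
theorem log_expected_likelihood_decomposition (N : ℕ) (hN : 1 ≤ N)
    (lam μ : Fin N → ℝ) (hlam : ∀ i, 0 < lam i) (hμ : ∀ i, 0 < μ i)
    (Δ : Fin N → ℝ) (hΔ : ∀ i, Δ i = (⌈μ i⌉ : ℝ) - μ i)
    (δ : (Fin N → Bool) → Fin N → ℝ)
    (hδ : ∀ s i, δ s i = Δ i - if s i then 1 else 0)
    (ε A Shat : ℝ)
    (hε : ε = 2 ^ N * Real.exp (-(∑ i, μ i)) *
      ∏ i, μ i ^ (μ i) / Real.Gamma (1 + μ i))
    (hA : A = Real.exp (-(∑ i, (lam i + μ i))) * (1 / ε) *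
      ∑ s : Fin N → Bool, ∏ i,
        (lam i * μ i) ^ (μ i + δ s i) / (Real.Gamma (1 + μ i + δ s i)) ^ 2)
    (hShat : Shat = ∑ s : Fin N → Bool, ∏ i,
        (lam i * μ i) ^ (δ s i) / (Real.Gamma (1 + μ i + δ s i)) ^ 2) :
    0 < A ∧ 0 < Shat ∧
      Real.log A = -(N : ℝ) * Real.log 2 +
        (∑ i, (-lam i + μ i * Real.log (lam i) +
          Real.log (Real.Gamma (1 + μ i)))) +
        Real.log Shat := by
  have hGδ : ∀ s i, 0 < Real.Gamma (1 + μ i + δ s i) := fun s i => by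
    rw [hδ, hΔ]
    exact Gamma_one_add_ceil_shift_pos (hμ i) (s i)
  have hG : ∀ i, 0 < Real.Gamma (1 + μ i) := fun i =>
    Real.Gamma_pos_of_pos (by linarith [hμ i])
  have hlamμ : ∀ i, 0 < lam i * μ i := fun i => mul_pos (hlam i) (hμ i)
  have hShat_pos : 0 < Shat := by
    rw [hShat]
    exact Finset.sum_pos (fun s _ => Finset.prod_pos fun i _ =>
      div_pos (Real.rpow_pos_of_pos (hlamμ i) _) (pow_pos (hGδ s i) 2)) Finset.univ_nonempty
  have hfactor : ∀ i, 0 < μ i ^ μ i / Real.Gamma (1 + μ i) := fun i =>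
    div_pos (Real.rpow_pos_of_pos (hμ i) _) (hG i)
  have hprod : 0 < ∏ i, μ i ^ μ i / Real.Gamma (1 + μ i) :=
    Finset.prod_pos fun i _ => hfactor i
  have hε_pos : 0 < ε := by
    rw [hε]
    positivity
  have hpow : 0 < ∏ i, (lam i * μ i) ^ μ i :=
    Finset.prod_pos fun i _ => Real.rpow_pos_of_pos (hlamμ i) _
  have hsum : (∑ s : Fin N → Bool, ∏ i,
      (lam i * μ i) ^ (μ i + δ s i) / (Real.Gamma (1 + μ i + δ s i)) ^ 2) =
      (∏ i, (lam i * μ i) ^ μ i) * Shat := by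
    rw [hShat, Finset.mul_sum]
    refine Finset.sum_congr rfl fun s _ => ?_
    rw [← Finset.prod_mul_distrib]
    refine Finset.prod_congr rfl fun i _ => ?_
    rw [Real.rpow_add (hlamμ i), mul_div_assoc]
  rw [hsum] at hA
  have hlogε : Real.log ε = N * Real.log 2 - ∑ i, μ i +
      ∑ i, (μ i * Real.log (μ i) - Real.log (Real.Gamma (1 + μ i))) := by
    rw [hε, Real.log_mul (by positivity) hprod.ne',
      Real.log_mul (by positivity) (Real.exp_pos _).ne', Real.log_pow, Real.log_exp,
      Real.log_prod fun i _ => (hfactor i).ne', ← sub_eq_add_neg]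
    congr 1
    refine Finset.sum_congr rfl fun i _ => ?_
    rw [Real.log_div (Real.rpow_pos_of_pos (hμ i) _).ne' (hG i).ne', Real.log_rpow (hμ i)]
  have hlogpow : Real.log (∏ i, (lam i * μ i) ^ μ i) =
      ∑ i, (μ i * Real.log (lam i) + μ i * Real.log (μ i)) := by
    rw [Real.log_prod fun i _ => (Real.rpow_pos_of_pos (hlamμ i) _).ne']
    refine Finset.sum_congr rfl fun i _ => ?_
    rw [Real.log_rpow (hlamμ i), Real.log_mul (hlam i).ne' (hμ i).ne', mul_add]
  refine ⟨by rw [hA]; positivity, hShat_pos, ?_⟩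
  rw [hA, Real.log_mul (by positivity) (by positivity),
    Real.log_mul (Real.exp_pos _).ne' (by positivity), Real.log_mul hpow.ne' hShat_pos.ne',
    Real.log_exp, one_div, Real.log_inv, hlogε, hlogpow]
  simp only [Finset.sum_add_distrib, Finset.sum_sub_distrib, Finset.sum_neg_distrib]
  ring
end
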